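/- For every smooth matrix field S : ℝ³ → ℝ^{3×3} one has Rot((Rot(skw S))^⊤) = skw Rot((Rot S)^⊤), i.e. RotRot^⊤(skw S) = skw(RotRot^⊤ S). -/

import Mathlib

open Matrix

noncomputable section

/-- Points of `ℝ³`. -/
abbrev V3 := Fin 3 → ℝ
/-- Real `3×3` matrices. -/
abbrev M3 := Matrix (Fin 3) (Fin 3) ℝ

/-- Partial derivative `∂ᵢ f` of a scalar function on `ℝ³`. -/
def pd (i : Fin 3) (f : V3 → ℝ) (x : V3) : ℝ := fderiv ℝ f x (Pi.single i 1)

/-- Gradient of a scalar function. -/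
def grad (f : V3 → ℝ) (x : V3) : V3 := fun i => pd i f x

/-- Divergence of a vector field. -/
def vdiv (v : V3 → V3) (x : V3) : ℝ := ∑ i, pd i (fun y => v y i) x

/-- Curl (rotation) of a vector field. -/
def vrot (v : V3 → V3) (x : V3) : V3 :=
  ![pd 1 (fun y => v y 2) x - pd 2 (fun y => v y 1) x,
    pd 2 (fun y => v y 0) x - pd 0 (fun y => v y 2) x,
    pd 0 (fun y => v y 1) x - pd 1 (fun y => v y 0) x]

/-- Jacobian matrix `(Grad v)_{ij} = ∂_j v_i` of a vector field. -/
def vGrad (v : V3 → V3) (x : V3) : M3 := Matrix.of fun i j => pd j (fun y => v y i) x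

/-- Row-wise curl of a matrix field. -/
def mRot (S : V3 → M3) (x : V3) : M3 := Matrix.of fun i => vrot (fun y => S y i) x

/-- Row-wise divergence of a matrix field. -/
def mDiv (S : V3 → M3) (x : V3) : V3 := fun i => vdiv (fun y => S y i) x

/-- The second order operator `RotRot^⊤ S = Rot ((Rot S)ᵀ)`. -/
def rotRotT (S : V3 → M3) (x : V3) : M3 := mRot (fun y => (mRot S y)ᵀ) x

/-- Symmetric part of a matrix. -/
def msym (M : M3) : M3 := (2⁻¹ : ℝ) • (M + Mᵀ)

/-- Skew-symmetric part of a matrix. -/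
def mskw (M : M3) : M3 := (2⁻¹ : ℝ) • (M - Mᵀ)

/-- Deviatoric (trace-free) part of a matrix. -/
def mdev (M : M3) : M3 := M - (Matrix.trace M / 3) • (1 : M3)

/-- The skew-symmetric matrix `spn w` with `(spn w) x = w × x`. -/
def spn (w : V3) : M3 := !![0, -w 2, w 1; w 2, 0, -w 0; -w 1, w 0, 0]

/-- The axial vector of a (skew-symmetric) matrix; inverse of `spn`. -/
def spnInv (M : M3) : V3 := ![M 2 1, M 0 2, M 1 0]

end

theorem ContDiff.pd {f : V3 → ℝ} (hf : ContDiff ℝ (⊤ : ℕ∞) f) (i : Fin 3) :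
    ContDiff ℝ (⊤ : ℕ∞) (pd i f) :=
  (hf.fderiv_right (by simp)).clm_apply contDiff_const

theorem pd_sub (i : Fin 3) {f g : V3 → ℝ} (hf : Differentiable ℝ f) (hg : Differentiable ℝ g) :
    pd i (fun y => f y - g y) = fun y => pd i f y - pd i g y := by
  funext x
  simp [pd, fderiv_fun_sub (hf x) (hg x)]

theorem pd_const_mul (i : Fin 3) (c : ℝ) {f : V3 → ℝ} (hf : Differentiable ℝ f) :
    pd i (fun y => c * f y) = fun y => c * pd i f y := by
  funext x
  simp [pd, fderiv_const_mul (hf x)]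

/-- Partial derivatives of a smooth function commute. -/
theorem pd_comm {f : V3 → ℝ} (hf : ContDiff ℝ (⊤ : ℕ∞) f) (i j : Fin 3) (x : V3) :
    pd i (pd j f) x = pd j (pd i f) x := by
  have hd : DifferentiableAt ℝ (fderiv ℝ f) x :=
    (hf.fderiv_right (m := (⊤ : ℕ∞)) (by simp)).differentiable (by simp) x
  have second (k l : Fin 3) : pd k (pd l f) x
      = fderiv ℝ (fderiv ℝ f) x (Pi.single k 1) (Pi.single l 1) := by
    change fderiv ℝ (fun y => fderiv ℝ f y (Pi.single l 1)) x (Pi.single k 1) = _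
    rw [fderiv_clm_apply hd (differentiableAt_const _)]
    simp
  rw [second, second]
  exact (hf.contDiffAt.isSymmSndFDerivAt (by
    rw [minSmoothness_of_isRCLikeNormedField]
    exact WithTop.coe_le_coe.2 (le_top : (2 : ℕ∞) ≤ ⊤))).eq _ _

/-- Second derivatives of a difference. -/
theorem pd_pd_sub (i : Fin 3) {f g : V3 → ℝ} (hf : ContDiff ℝ (⊤ : ℕ∞) f)
    (hg : ContDiff ℝ (⊤ : ℕ∞) g) (k l : Fin 3) (x : V3) :
    pd i (fun y => pd k f y - pd l g y) x = pd i (pd k f) x - pd i (pd l g) x :=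
  congrFun (pd_sub i ((hf.pd k).differentiable (by simp)) ((hg.pd l).differentiable (by simp))) x

theorem pd_pd_mskw {S : V3 → M3} (hS : ∀ i j, ContDiff ℝ (⊤ : ℕ∞) fun y => S y i j)
    (i j k l : Fin 3) (x : V3) :
    pd k (pd l fun y => mskw (S y) i j) x
      = 2⁻¹ * (pd k (pd l fun y => S y i j) x - pd k (pd l fun y => S y j i) x) := by
  have hd (a b : Fin 3) : Differentiable ℝ fun y => S y a b := (hS a b).differentiable (by simp)
  have hd' (a b : Fin 3) : Differentiable ℝ (pd l fun y => S y a b) :=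
    ((hS a b).pd l).differentiable (by simp)
  change pd k (pd l fun y => 2⁻¹ * (S y i j - S y j i)) x = _
  rw [pd_const_mul l _ ((hd i j).fun_sub (hd j i)), pd_sub l (hd i j) (hd j i),
    pd_const_mul k _ ((hd' i j).fun_sub (hd' j i)), pd_sub k (hd' i j) (hd' j i)]

theorem ContDiff.mskw {S : V3 → M3} (hS : ∀ i j, ContDiff ℝ (⊤ : ℕ∞) fun y => S y i j)
    (i j : Fin 3) : ContDiff ℝ (⊤ : ℕ∞) fun y => mskw (S y) i j :=
  contDiff_const.mul ((hS i j).sub (hS j i))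

/-- `RotRot^⊤ (skw S) = skw (RotRot^⊤ S)`. -/
theorem rotRotT_mskw (S : V3 → M3)
    (hS : ∀ i j, ContDiff ℝ (⊤ : ℕ∞) fun y => S y i j) :
    ∀ x, rotRotT (fun y => mskw (S y)) x = mskw (rotRotT S x) := by
  intro x
  have hskw := ContDiff.mskw hS
  have skw_apply (M : M3) (i j : Fin 3) : mskw M i j = 2⁻¹ * (M i j - M j i) := rfl
  ext i j
  rw [skw_apply]
  fin_cases i <;> fin_cases j <;>
    simp [rotRotT, mRot, vrot, pd_pd_sub, hS, hskw, pd_pd_mskw hS,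
      pd_comm (hS _ _) 1 0, pd_comm (hS _ _) 2 0, pd_comm (hS _ _) 2 1] <;>
    ring
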